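/- arXiv:1810.01784 — 3 statements merged into one kernel-verified Lean document; each statement's English description precedes it below -/
import Mathlib

section
/- Let D = (V,E) be a nonempty, nontrivial, simple digraph on n ≥ 2 nodes with Laplacian matrix L, and let S ⊆ V with indicator vector σ(S). Then R(S) = max over j ∈ {1,...,n} of L_j σ(S), where R is the reachability function. -/
/-- The in-neighbor set `N_j = {i : (i,j) ∈ E}` of node `j` in the digraph with
edge relation `E` (where `E i j` means there is a directed edge from `i` to `j`). -/
def inNbrs {n : ℕ} (E : Fin n → Fin n → Prop) [DecidableRel E] (j : Fin n) : Finset (Fin n) :=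
  Finset.univ.filter (fun i => E i j)

/-- A subset `S` is `r`-reachable if some `i ∈ S` has at least `r` in-neighbors outside `S`. -/
def rReachable {n : ℕ} (E : Fin n → Fin n → Prop) [DecidableRel E]
    (S : Finset (Fin n)) (r : ℕ) : Prop :=
  ∃ i ∈ S, r ≤ ((inNbrs E i) \ S).card

/-- A digraph is `r`-robust if for every pair of nonempty disjoint subsets, at least
one of them is `r`-reachable. -/
def rRobust {n : ℕ} (E : Fin n → Fin n → Prop) [DecidableRel E] (r : ℕ) : Prop :=
  ∀ S1 S2 : Finset (Fin n), S1.Nonempty → S2.Nonempty → Disjoint S1 S2 →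
    rReachable E S1 r ∨ rReachable E S2 r

/-- The reachability function `R(S) = max_{i ∈ S} |N_i \ S|` (with `R(∅) = 0`). -/
def reach {n : ℕ} (E : Fin n → Fin n → Prop) [DecidableRel E] (S : Finset (Fin n)) : ℕ :=
  S.sup (fun i => ((inNbrs E i) \ S).card)

/-- `r_max(D)`: the maximum integer `r` for which the digraph is `r`-robust. -/
noncomputable def rMax {n : ℕ} (E : Fin n → Fin n → Prop) [DecidableRel E] : ℕ :=
  sSup {r : ℕ | rRobust E r}

/-- The graph Laplacian: `L j j = |N_j|`, `L j i = -1` if `i ∈ N_j`, and `0` otherwise. -/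
def Lap {n : ℕ} (E : Fin n → Fin n → Prop) [DecidableRel E] : Matrix (Fin n) (Fin n) ℤ :=
  fun j i => if i = j then ((inNbrs E j).card : ℤ) else if i ∈ inNbrs E j then -1 else 0

/-- The indicator vector `σ(S) ∈ {0,1}^n` of a subset `S`. -/
def indVec {n : ℕ} (S : Finset (Fin n)) : Fin n → ℤ :=
  fun j => if j ∈ S then 1 else 0

/-- Each row satisfies `L_j σ(S) = [j ∈ S] |N_j| - |N_j ∩ S|`. -/
theorem lap_mulVec_indVec {n : ℕ} (E : Fin n → Fin n → Prop) [DecidableRel E]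
    (hirr : ∀ i, ¬ E i i) (S : Finset (Fin n)) (j : Fin n) :
    (Lap E).mulVec (indVec S) j =
      (if j ∈ S then ((inNbrs E j).card : ℤ) else 0) - ((inNbrs E j ∩ S).card : ℤ) := by
  have entry : ∀ i, Lap E j i * indVec S i =
      (if i = j then (if j ∈ S then ((inNbrs E j).card : ℤ) else 0) else 0) -
        (if i ∈ inNbrs E j ∩ S then 1 else 0) := by
    intro i
    have hj : j ∉ inNbrs E j := by simp [inNbrs, hirr]
    by_cases hij : i = j
    · subst hij
      simp [Lap, indVec, hj]
    · by_cases hN : i ∈ inNbrs E j <;> by_cases hS : i ∈ S <;> simp [Lap, indVec, hij, hN, hS]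
  simp only [Matrix.mulVec, dotProduct, entry, Finset.sum_sub_distrib]
  simp [-Finset.mem_inter]

theorem lap_mulVec_indVec_of_mem {n : ℕ} (E : Fin n → Fin n → Prop) [DecidableRel E]
    (hirr : ∀ i, ¬ E i i) {S : Finset (Fin n)} {j : Fin n} (hj : j ∈ S) :
    (Lap E).mulVec (indVec S) j = ((inNbrs E j \ S).card : ℤ) := by
  rw [lap_mulVec_indVec E hirr, if_pos hj]
  have := Finset.card_sdiff_add_card_inter (inNbrs E j) S
  omega

theorem lap_mulVec_indVec_nonpos_of_notMem {n : ℕ} (E : Fin n → Fin n → Prop) [DecidableRel E]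
    (hirr : ∀ i, ¬ E i i) {S : Finset (Fin n)} {j : Fin n} (hj : j ∉ S) :
    (Lap E).mulVec (indVec S) j ≤ 0 := by
  rw [lap_mulVec_indVec E hirr, if_neg hj]
  omega

/-- `R(S) = max_{j ∈ {1,…,n}} L_j σ(S)`. -/
theorem reach_eq_max_lap_mulVec {n : ℕ} (hn : 2 ≤ n) (E : Fin n → Fin n → Prop) [DecidableRel E]
    (hirr : ∀ i, ¬ E i i) (S : Finset (Fin n)) :
    (reach E S : ℤ) =
      Finset.univ.sup'
        (Finset.univ_nonempty_iff.mpr (Fin.pos_iff_nonempty.mp (by omega)))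
        (fun j => (Lap E).mulVec (indVec S) j) := by
  apply le_antisymm
  · rcases S.eq_empty_or_nonempty with rfl | hS
    · refine Finset.le_sup'_of_le _ (Finset.mem_univ ⟨0, by omega⟩) ?_
      rw [lap_mulVec_indVec E hirr]
      simp [reach]
    · obtain ⟨i, hi, heq⟩ := S.exists_mem_eq_sup hS (fun i => ((inNbrs E i) \ S).card)
      refine Finset.le_sup'_of_le _ (Finset.mem_univ i) ?_
      rw [lap_mulVec_indVec_of_mem E hirr hi, reach, heq]
  · refine Finset.sup'_le _ _ fun j _ => ?_
    by_cases hj : j ∈ S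
    · rw [lap_mulVec_indVec_of_mem E hirr hj]
      exact_mod_cast Finset.le_sup (f := fun i => ((inNbrs E i) \ S).card) hj
    · exact (lap_mulVec_indVec_nonpos_of_notMem E hirr hj).trans (Int.natCast_nonneg _)
end

section
/- Let D = (V,E) be a nonempty, nontrivial, simple digraph on n ≥ 2 nodes with Laplacian matrix L. Then r_max(D), the maximum integer r for which D is r-robust, equals the minimum over all pairs of binary vectors (b1,b2) ∈ {0,1}^n × {0,1}^n satisfying b1 + b2 ≤ 1 componentwise, 1 ≤ 1ᵀb1 ≤ n−1, and 1 ≤ 1ᵀb2 ≤ n−1, of max( max_{i∈{1,...,n}} L_i b1, max_{j∈{1,...,n}} L_j b2 ). -/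
/-- For nonempty `S`, being `r`-reachable means `r ≤ R(S)`. -/
theorem rReachable_iff_le_reach {n : ℕ} (E : Fin n → Fin n → Prop) [DecidableRel E]
    {S : Finset (Fin n)} (hS : S.Nonempty) (r : ℕ) :
    rReachable E S r ↔ r ≤ reach E S := by
  constructor
  · rintro ⟨i, hi, hr⟩
    exact hr.trans (Finset.le_sup (f := fun i => ((inNbrs E i) \ S).card) hi)
  · intro hr
    obtain ⟨i, hi, h⟩ := S.exists_mem_eq_sup hS (fun i => ((inNbrs E i) \ S).card)
    exact ⟨i, hi, hr.trans h.le⟩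

/-- The rows of the Laplacian applied to an indicator vector. -/
theorem Lap_mulVec_indVec {n : ℕ} (E : Fin n → Fin n → Prop) [DecidableRel E]
    (hirr : ∀ i, ¬ E i i) (S : Finset (Fin n)) (i : Fin n) :
    (Lap E).mulVec (indVec S) i =
      (if i ∈ S then ((inNbrs E i).card : ℤ) else 0) - ((inNbrs E i ∩ S).card : ℤ) := by
  have hi : i ∉ inNbrs E i := by simp [inNbrs, hirr]
  have hterm : ∀ j, Lap E i j * indVec S j =
      (if j = i then (if i ∈ S then ((inNbrs E i).card : ℤ) else 0) else 0) -
        (if j ∈ inNbrs E i ∩ S then 1 else 0) := by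
    intro j
    by_cases hji : j = i
    · subst hji
      simp [Lap, indVec, hi]
    · by_cases hN : j ∈ inNbrs E i <;> by_cases hjS : j ∈ S <;>
        simp [Lap, indVec, hji, hN, hjS]
  simp only [Matrix.mulVec, dotProduct, hterm, Finset.sum_sub_distrib, Finset.sum_boole,
    Finset.filter_univ_mem, Finset.sum_ite_eq', Finset.mem_univ, if_true]

/-- The largest entry of `L σ(S)` is `R(S)` for nonempty `S`. -/
theorem sup'_Lap_mulVec_indVec {n : ℕ} (E : Fin n → Fin n → Prop) [DecidableRel E]
    (hirr : ∀ i, ¬ E i i) {S : Finset (Fin n)} (hS : S.Nonempty)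
    (hne : (Finset.univ : Finset (Fin n)).Nonempty) :
    Finset.univ.sup' hne (fun i => (Lap E).mulVec (indVec S) i) = (reach E S : ℤ) := by
  have hmem : ∀ i ∈ S, (Lap E).mulVec (indVec S) i = ((inNbrs E i \ S).card : ℤ) := by
    intro i hi
    have hcard := Finset.card_sdiff_add_card_inter (inNbrs E i) S
    rw [Lap_mulVec_indVec E hirr, if_pos hi]
    omega
  apply le_antisymm
  · refine Finset.sup'_le _ _ fun i _ => ?_
    by_cases hi : i ∈ S
    · rw [hmem i hi]
      exact_mod_cast Finset.le_sup (f := fun i => ((inNbrs E i) \ S).card) hi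
    · rw [Lap_mulVec_indVec E hirr, if_neg hi]
      omega
  · obtain ⟨i, hi, h⟩ := S.exists_mem_eq_sup hS (fun i => ((inNbrs E i) \ S).card)
    rw [reach, h, ← hmem i hi]
    exact Finset.le_sup' (fun i => (Lap E).mulVec (indVec S) i) (Finset.mem_univ i)

/-- `r_max(D)` is the minimum of `max (R(S₁)) (R(S₂))` over nonempty disjoint pairs. -/
theorem isLeast_rMax_reach {n : ℕ} (hn : 2 ≤ n) (E : Fin n → Fin n → Prop) [DecidableRel E] :
    IsLeast {m : ℕ | ∃ S1 S2 : Finset (Fin n), S1.Nonempty ∧ S2.Nonempty ∧ Disjoint S1 S2 ∧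
      m = max (reach E S1) (reach E S2)} (rMax E) := by
  let T := {m : ℕ | ∃ S1 S2 : Finset (Fin n), S1.Nonempty ∧ S2.Nonempty ∧ Disjoint S1 S2 ∧
      m = max (reach E S1) (reach E S2)}
  have hne : T.Nonempty :=
    ⟨_, {⟨0, by omega⟩}, {⟨1, by omega⟩}, Finset.singleton_nonempty _, Finset.singleton_nonempty _,
      Finset.disjoint_singleton.mpr (by simp [Fin.ext_iff]), rfl⟩
  have hrobust : {r : ℕ | rRobust E r} = Set.Iic (sInf T) := by
    ext r
    simp only [Set.mem_ofPred_eq, Set.mem_Iic, le_csInf_iff (OrderBot.bddBelow T) hne]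
    constructor
    · rintro h _ ⟨S1, S2, h1, h2, hd, rfl⟩
      rw [le_max_iff, ← rReachable_iff_le_reach E h1, ← rReachable_iff_le_reach E h2]
      exact h S1 S2 h1 h2 hd
    · intro h S1 S2 h1 h2 hd
      rw [rReachable_iff_le_reach E h1, rReachable_iff_le_reach E h2, ← le_max_iff]
      exact h _ ⟨S1, S2, h1, h2, hd, rfl⟩
  rw [rMax, hrobust, csSup_Iic]
  exact ⟨Nat.sInf_mem hne, fun _ hm => Nat.sInf_le hm⟩

theorem sum_indVec {n : ℕ} (S : Finset (Fin n)) : ∑ j, indVec S j = (S.card : ℤ) := by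
  simp [indVec]

/-- Every binary vector is an indicator vector. -/
theorem exists_eq_indVec {n : ℕ} {b : Fin n → ℤ} (hb : ∀ j, b j = 0 ∨ b j = 1) :
    ∃ S : Finset (Fin n), b = indVec S := by
  refine ⟨Finset.univ.filter (fun j => b j = 1), funext fun j => ?_⟩
  rcases hb j with h | h <;> simp [indVec, h]

/-- `r_max(D)` equals the minimum, over all pairs of binary vectors
`(b1,b2)` satisfying `b1 + b2 ≤ 1` componentwise, `1 ≤ 1ᵀb1 ≤ n−1`, `1 ≤ 1ᵀb2 ≤ n−1`,
of `max(max_i L_i b1, max_j L_j b2)`. -/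
theorem rMax_eq_min_milp {n : ℕ} (hn : 2 ≤ n) (E : Fin n → Fin n → Prop) [DecidableRel E]
    (hirr : ∀ i, ¬ E i i) :
    IsLeast
      {x : ℤ | ∃ b1 b2 : Fin n → ℤ,
        (∀ j, b1 j = 0 ∨ b1 j = 1) ∧ (∀ j, b2 j = 0 ∨ b2 j = 1) ∧
        (∀ j, b1 j + b2 j ≤ 1) ∧
        1 ≤ ∑ j, b1 j ∧ ∑ j, b1 j ≤ (n : ℤ) - 1 ∧
        1 ≤ ∑ j, b2 j ∧ ∑ j, b2 j ≤ (n : ℤ) - 1 ∧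
        x = max
          (Finset.univ.sup'
            (Finset.univ_nonempty_iff.mpr (Fin.pos_iff_nonempty.mp (by omega)))
            (fun i => (Lap E).mulVec b1 i))
          (Finset.univ.sup'
            (Finset.univ_nonempty_iff.mpr (Fin.pos_iff_nonempty.mp (by omega)))
            (fun j => (Lap E).mulVec b2 j))}
      ((rMax E : ℤ)) := by
  have hbin : ∀ (S : Finset (Fin n)) (j : Fin n), indVec S j = 0 ∨ indVec S j = 1 := by
    intro S j
    by_cases h : j ∈ S <;> simp [indVec, h]
  obtain ⟨⟨S1, S2, h1, h2, hd, hmax⟩, hleast⟩ := isLeast_rMax_reach hn E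
  constructor
  · have hcard : S1.card + S2.card ≤ n := by
      rw [← Finset.card_union_of_disjoint hd]
      simpa using Finset.card_le_univ (S1 ∪ S2)
    have hpos1 := h1.card_pos
    have hpos2 := h2.card_pos
    refine ⟨indVec S1, indVec S2, hbin S1, hbin S2, fun j => ?_, ?_, ?_, ?_, ?_, ?_⟩
    · by_cases hj : j ∈ S1
      · simp [indVec, hj, Finset.disjoint_left.mp hd hj]
      · by_cases hj2 : j ∈ S2 <;> simp [indVec, hj, hj2]
    iterate 4 (rw [sum_indVec]; omega)
    rw [sup'_Lap_mulVec_indVec E hirr h1, sup'_Lap_mulVec_indVec E hirr h2, hmax]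
    exact Nat.cast_max _ _
  · rintro x ⟨b1, b2, hb1, hb2, hle, hs1, -, hs2, -, rfl⟩
    obtain ⟨T1, rfl⟩ := exists_eq_indVec hb1
    obtain ⟨T2, rfl⟩ := exists_eq_indVec hb2
    rw [sum_indVec] at hs1 hs2
    have hT1 : T1.Nonempty := Finset.card_pos.mp (by omega)
    have hT2 : T2.Nonempty := Finset.card_pos.mp (by omega)
    have hT : Disjoint T1 T2 := Finset.disjoint_left.mpr fun j hj1 hj2 => by
      have := hle j
      simp [indVec, hj1, hj2] at this
    rw [sup'_Lap_mulVec_indVec E hirr hT1, sup'_Lap_mulVec_indVec E hirr hT2]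
    exact_mod_cast hleast ⟨T1, T2, hT1, hT2, hT, rfl⟩
end

section
/- Let D = (V,E) be a nonempty, nontrivial, simple digraph on n ≥ 2 nodes. Then r_max(D), the maximum integer r for which D is r-robust, satisfies r_max(D) ≤ ⌈n/2⌉. -/
/-- The outside in-neighbors of a node of `S` all lie in the complement of `S`. -/
theorem rReachable.le_card_compl {n : ℕ} {E : Fin n → Fin n → Prop} [DecidableRel E]
    {S : Finset (Fin n)} {r : ℕ} (h : rReachable E S r) : r ≤ Sᶜ.card := by
  obtain ⟨i, -, hr⟩ := h
  refine hr.trans (Finset.card_le_card fun x hx => ?_)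
  exact Finset.mem_compl.2 (Finset.mem_sdiff.1 hx).2

/-- Splitting the nodes into two halves bounds the robustness of a digraph. -/
theorem rRobust.le_half {n : ℕ} (hn : 2 ≤ n) {E : Fin n → Fin n → Prop} [DecidableRel E]
    {r : ℕ} (h : rRobust E r) : r ≤ (n + 1) / 2 := by
  obtain ⟨S, -, hS⟩ := Finset.exists_subset_card_eq
    (show n / 2 ≤ (Finset.univ : Finset (Fin n)).card by simp; omega)
  have hSc : Sᶜ.card = n - n / 2 := by rw [Finset.card_compl, hS, Fintype.card_fin]
  rcases h S Sᶜ (Finset.card_pos.1 (by omega)) (Finset.card_pos.1 (by omega))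
    disjoint_compl_right with h | h
  · have := h.le_card_compl
    omega
  · have := h.le_card_compl
    rw [compl_compl] at this
    omega

/-- `r_max(D) ≤ ⌈n/2⌉` for every nonempty, nontrivial, simple digraph on
`n ≥ 2` nodes. -/
theorem rMax_le_ceil_half {n : ℕ} (hn : 2 ≤ n) (E : Fin n → Fin n → Prop) [DecidableRel E]
    (hirr : ∀ i, ¬ E i i) :
    (rMax E : ℤ) ≤ ⌈(n : ℚ) / 2⌉ := by
  have hle : rMax E ≤ (n + 1) / 2 := csSup_le' fun _ hr => rRobust.le_half hn hr
  have hceil : (n : ℚ) / 2 ≤ (⌈(n : ℚ) / 2⌉ : ℤ) := Int.le_ceil _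
  have hcast : (n : ℤ) ≤ 2 * ⌈(n : ℚ) / 2⌉ := by
    have : (n : ℚ) ≤ 2 * (⌈(n : ℚ) / 2⌉ : ℤ) := by linarith
    exact_mod_cast this
  omega
end
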